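/- arXiv:2003.00433 — 5 statements merged into one kernel-verified Lean document; each statement's English description precedes it below -/
import Mathlib

section
/- Let Φ ∈ ℝ^{N×d}, let D ∈ ℝ^{N×N} be symmetric positive definite, let P ∈ ℝ^{N×N}, γ ∈ ℝ, and R ∈ ℝ^N. Suppose C := Φ^T D Φ is invertible, and define the D-weighted projection Π := Φ C⁻¹ Φ^T D onto the column span of Φ, A := Φ^T D (I − γP) Φ, and b := Φ^T D R. Then for every θ ∈ ℝ^d: ‖Π(Φθ − γ P Φ θ − R)‖²_D = (Aθ − b)^T C⁻¹ (Aθ − b), where ‖x‖²_D denotes x^T D x. -/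
open Matrix

/-- **MSPBE identity.** With features `Φ`, symmetric positive definite weight `D`,
transition matrix `P`, discount `γ` and rewards `R`, if `C = Φᵀ D Φ` is invertible and
`Π = Φ C⁻¹ Φᵀ D` is the `D`-weighted projection, `A = Φᵀ D (I - γ P) Φ`, `b = Φᵀ D R`,
then `‖Π(Φθ - γPΦθ - R)‖²_D = (Aθ - b)ᵀ C⁻¹ (Aθ - b)` for every `θ`. -/
theorem mspbe_projection_identity {N d : ℕ}
    (Φ : Matrix (Fin N) (Fin d) ℝ) (D P : Matrix (Fin N) (Fin N) ℝ)
    (hD : D.PosDef) (γ : ℝ) (R : Fin N → ℝ)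
    (C : Matrix (Fin d) (Fin d) ℝ) (hC : C = Φᵀ * D * Φ) (hCinv : IsUnit C)
    (Pi : Matrix (Fin N) (Fin N) ℝ) (hPi : Pi = Φ * C⁻¹ * Φᵀ * D)
    (A : Matrix (Fin d) (Fin d) ℝ) (hA : A = Φᵀ * D * (1 - γ • P) * Φ)
    (b : Fin d → ℝ) (hb : b = (Φᵀ * D).mulVec R) :
    ∀ θ : Fin d → ℝ,
      (Pi.mulVec (Φ.mulVec θ - γ • P.mulVec (Φ.mulVec θ) - R)) ⬝ᵥ
        D.mulVec (Pi.mulVec (Φ.mulVec θ - γ • P.mulVec (Φ.mulVec θ) - R)) =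
      (A.mulVec θ - b) ⬝ᵥ C⁻¹.mulVec (A.mulVec θ - b) := by
  intro θ
  set x := Φ.mulVec θ - γ • P.mulVec (Φ.mulVec θ) - R with hx
  have hw : A.mulVec θ - b = (Φᵀ * D).mulVec x := by
    rw [hA, hb, hx, mulVec_sub, ← mulVec_mulVec, ← mulVec_mulVec, sub_mulVec, one_mulVec,
      smul_mulVec]
  have hPx : Pi.mulVec x = Φ.mulVec (C⁻¹.mulVec (A.mulVec θ - b)) := by
    rw [hw, hPi, mulVec_mulVec, mulVec_mulVec]
    simp only [Matrix.mul_assoc]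
  rw [hPx]
  generalize A.mulVec θ - b = w
  have hCu : Φᵀ.mulVec (D.mulVec (Φ.mulVec (C⁻¹.mulVec w))) = w := by
    rw [mulVec_mulVec, mulVec_mulVec, ← hC, mulVec_mulVec,
      mul_nonsing_inv C ((isUnit_iff_isUnit_det C).mp hCinv), one_mulVec]
  rw [dotProduct_comm, dotProduct_mulVec, ← mulVec_transpose, hCu]
end

section
/- Let A ∈ ℝ^{d×d}, let C ∈ ℝ^{d×d} be symmetric positive definite, let ρ > 0, ζ > 0, and define G = [[ρ I_d, −√ζ A^T], [√ζ A, ζ C]] ∈ ℝ^{2d×2d}. Set α = min(ρ, ζ λ_min(C)) and L = ‖G‖₂ (the spectral/operator 2-norm). Fix any g ∈ ℝ^{2d} and let z* = G⁻¹ g (G is invertible). Then for every stepsize η ∈ (0, α/L²] and every z ∈ ℝ^{2d}: ‖z − η(G z − g) − z*‖ ≤ (1 − η α / 2) ‖z − z*‖. -/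
open Matrix

theorem Matrix.IsHermitian.iInf_eigenvalues_mul_dotProduct_le {n : Type*} [Fintype n]
    [DecidableEq n] {C : Matrix n n ℝ} (hC : C.IsHermitian) (x : n → ℝ) :
    (⨅ i, hC.eigenvalues i) * (x ⬝ᵥ x) ≤ x ⬝ᵥ C *ᵥ x := by
  open scoped MatrixOrder Matrix.Norms.L2Operator in
  have h : algebraMap ℝ (Matrix n n ℝ) (⨅ i, hC.eigenvalues i) ≤ C := by
    rw [algebraMap_le_iff_le_spectrum (ha := hC.isSelfAdjoint),
      hC.spectrum_real_eq_range_eigenvalues]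
    rintro _ ⟨i, rfl⟩
    exact ciInf_le (Set.finite_range _).bddBelow i
  open scoped MatrixOrder in
  have h' := (Matrix.le_iff.1 h).dotProduct_mulVec_nonneg x
  simpa [sub_mulVec, Algebra.algebraMap_eq_smul_one, smul_mulVec, dotProduct_sub] using h'

theorem Matrix.mulVec_dotProduct_mulVec_le {n : Type*} [Fintype n] [DecidableEq n]
    (M : Matrix n n ℝ) (x : n → ℝ) :
    M *ᵥ x ⬝ᵥ M *ᵥ x ≤ ‖Matrix.toEuclideanCLM (𝕜 := ℝ) M‖ ^ 2 * (x ⬝ᵥ x) := by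
  have key : ∀ y : n → ℝ, y ⬝ᵥ y = ‖WithLp.toLp 2 y‖ ^ 2 := fun y => by
    rw [EuclideanSpace.real_norm_sq_eq]
    simp [dotProduct, pow_two]
  have h := (Matrix.toEuclideanCLM (𝕜 := ℝ) M).le_opNorm (WithLp.toLp 2 x)
  rw [Matrix.toEuclideanCLM_toLp] at h
  rw [key, key, ← mul_pow]
  gcongr

theorem Matrix.mul_dotProduct_le_dotProduct_fromBlocks_mulVec {m n : Type*} [Fintype m] [Fintype n]
    {P : Matrix m m ℝ} {Q : Matrix n n ℝ} {B : Matrix n m ℝ} {c : ℝ}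
    (hP : ∀ x, c * (x ⬝ᵥ x) ≤ x ⬝ᵥ P *ᵥ x) (hQ : ∀ y, c * (y ⬝ᵥ y) ≤ y ⬝ᵥ Q *ᵥ y)
    (w : m ⊕ n → ℝ) :
    c * (w ⬝ᵥ w) ≤ w ⬝ᵥ fromBlocks P (-Bᵀ) B Q *ᵥ w := by
  obtain ⟨x, y, rfl⟩ : ∃ x y, w = Sum.elim x y :=
    ⟨w ∘ Sum.inl, w ∘ Sum.inr, (Sum.elim_comp_inl_inr w).symm⟩
  have hB : x ⬝ᵥ Bᵀ *ᵥ y = y ⬝ᵥ B *ᵥ x := by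
    rw [mulVec_transpose, dotProduct_comm, dotProduct_mulVec]
  simp only [fromBlocks_mulVec, sumElim_dotProduct_sumElim, Sum.elim_comp_inl, Sum.elim_comp_inr,
    dotProduct_add, neg_mulVec, dotProduct_neg, hB]
  linarith [hP x, hQ y]

/-- **Contraction of one scaled primal-dual gradient step.** With
`G = [[ρI, -√ζ Aᵀ], [√ζ A, ζ C]]`, `α = min(ρ, ζ λ_min(C))`, `L = ‖G‖₂` the spectral norm,
and `z* = G⁻¹ g`, for every stepsize `η ∈ (0, α/L²]` and every `z`:
`‖z - η(Gz - g) - z*‖ ≤ (1 - ηα/2)‖z - z*‖` in the Euclidean norm. -/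
theorem primal_dual_gradient_step_contraction {d : ℕ}
    (A C : Matrix (Fin d) (Fin d) ℝ) (hC : C.PosDef)
    (ρ ζ : ℝ) (hρ : 0 < ρ) (hζ : 0 < ζ)
    (G : Matrix (Fin d ⊕ Fin d) (Fin d ⊕ Fin d) ℝ)
    (hG : G = Matrix.fromBlocks (ρ • (1 : Matrix (Fin d) (Fin d) ℝ))
      (-(Real.sqrt ζ) • Aᵀ) ((Real.sqrt ζ) • A) (ζ • C))
    (α L : ℝ)
    (hα : α = min ρ (ζ * ⨅ i, hC.1.eigenvalues i))
    (hL : L = ‖Matrix.toEuclideanCLM (𝕜 := ℝ) G‖)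
    (g zs : Fin d ⊕ Fin d → ℝ) (hzs : zs = G⁻¹.mulVec g) :
    ∀ η : ℝ, 0 < η → η ≤ α / L ^ 2 → ∀ z : Fin d ⊕ Fin d → ℝ,
      Real.sqrt ((z - η • (G.mulVec z - g) - zs) ⬝ᵥ (z - η • (G.mulVec z - g) - zs)) ≤
        (1 - η * α / 2) * Real.sqrt ((z - zs) ⬝ᵥ (z - zs)) := by
  intro η hη hηα z
  have hquot : 0 < α / L ^ 2 := hη.trans_le hηα
  have hL2 : 0 < L ^ 2 := (sq_nonneg L).lt_of_ne fun h => by simp [← h] at hquot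
  have hα0 : 0 < α := (div_pos_iff_of_pos_right hL2).1 hquot
  have hηL : η * L ^ 2 ≤ α := (le_div_iff₀ hL2).1 hηα
  have hnonneg : ∀ {ι : Type} [Fintype ι] (x : ι → ℝ), 0 ≤ x ⬝ᵥ x := fun x =>
    Finset.sum_nonneg fun i _ => mul_self_nonneg (x i)
  have hmono : ∀ w, α * (w ⬝ᵥ w) ≤ w ⬝ᵥ G *ᵥ w := by
    have hG' : G = fromBlocks (ρ • 1) (-(√ζ • A)ᵀ) (√ζ • A) (ζ • C) := by
      rw [hG, transpose_smul, neg_smul]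
    rw [hG']
    refine mul_dotProduct_le_dotProduct_fromBlocks_mulVec (fun x => ?_) fun y => ?_
    · rw [smul_mulVec, one_mulVec, dotProduct_smul, smul_eq_mul]
      exact mul_le_mul_of_nonneg_right (hα ▸ min_le_left _ _) (hnonneg x)
    · rw [smul_mulVec, dotProduct_smul, smul_eq_mul]
      calc α * (y ⬝ᵥ y) ≤ ζ * (⨅ i, hC.1.eigenvalues i) * (y ⬝ᵥ y) :=
            mul_le_mul_of_nonneg_right (hα ▸ min_le_right _ _) (hnonneg y)
        _ ≤ ζ * (y ⬝ᵥ C *ᵥ y) := by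
            rw [mul_assoc]
            exact mul_le_mul_of_nonneg_left (hC.1.iInf_eigenvalues_mul_dotProduct_le y) hζ.le
  have hunit : IsUnit G := by
    rw [← mulVec_injective_iff_isUnit]
    refine (injective_iff_map_eq_zero G.mulVecLin).2 fun w hw => ?_
    have h := hmono w
    rw [mulVecLin_apply] at hw
    rw [hw, dotProduct_zero] at h
    exact dotProduct_self_eq_zero.1 (by nlinarith [hnonneg w])
  have hzero : G *ᵥ zs = g := by
    rw [hzs, mulVec_mulVec, mul_nonsing_inv _ ((isUnit_iff_isUnit_det G).1 hunit), one_mulVec]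
  have hstep : z - η • (G *ᵥ z - g) - zs = (z - zs) - η • G *ᵥ (z - zs) := by
    rw [mulVec_sub, hzero]
    abel
  rw [hstep]
  generalize z - zs = w
  have hbound : (w - η • G *ᵥ w) ⬝ᵥ (w - η • G *ᵥ w) ≤ (1 - η * α) * (w ⬝ᵥ w) := by
    have hexp : (w - η • G *ᵥ w) ⬝ᵥ (w - η • G *ᵥ w) =
        w ⬝ᵥ w - 2 * η * (w ⬝ᵥ G *ᵥ w) + η ^ 2 * (G *ᵥ w ⬝ᵥ G *ᵥ w) := by
      simp only [sub_dotProduct, dotProduct_sub, smul_dotProduct, dotProduct_smul, smul_eq_mul,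
        dotProduct_comm (G *ᵥ w) w]
      ring
    have hLw : G *ᵥ w ⬝ᵥ G *ᵥ w ≤ L ^ 2 * (w ⬝ᵥ w) := hL ▸ mulVec_dotProduct_mulVec_le G w
    have h₁ := mul_le_mul_of_nonneg_left (hmono w) hη.le
    have h₂ := mul_le_mul_of_nonneg_left hLw (sq_nonneg η)
    have h₃ := mul_le_mul_of_nonneg_left hηL (mul_nonneg hη.le (hnonneg w))
    rw [hexp]
    linarith
  rcases (hnonneg w).eq_or_lt with hw | hw
  · rw [← hw, mul_zero] at hbound
    rw [Real.sqrt_eq_zero_of_nonpos hbound, ← hw, Real.sqrt_zero, mul_zero]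
  · have hηα1 : 0 ≤ 1 - η * α :=
      nonneg_of_mul_nonneg_left ((hnonneg _).trans hbound) hw
    have hfac : 0 ≤ 1 - η * α / 2 := by linarith [mul_pos hη hα0]
    rw [← Real.sqrt_sq hfac, ← Real.sqrt_mul (sq_nonneg _)]
    refine Real.sqrt_le_sqrt (hbound.trans (mul_le_mul_of_nonneg_right ?_ hw.le))
    linarith [sq_nonneg (η * α)]
end

section
/- Let {p^k}_{k≥1} and {q^k}_{k≥1} be nonnegative real sequences, let r ∈ [0,1), and let j ≥ 1, l ≥ 0 be integers such that p^{t+j+l} ≤ r p^{t+l} + Σ_{i=0}^{j+l−1} q^{t+i} for all t ≥ 1. Let λ ∈ (0,1) satisfy λ^j > r, and define the λ-sequences p^{λ,k} = max_{1≤t≤k} p^t λ^{−t} and q^{λ,k} = max_{1≤t≤k} q^t λ^{−t}. Then for all k ≥ 1: p^{λ,k} ≤ ((j+l) / (λ^l (λ^j − r))) · q^{λ,k} + c_λ, where c_λ = (λ^j/(λ^j − r)) · max_{1≤t≤j+l} p^t λ^{−t} is a constant not depending on k. -/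
/-- **The λ-sequence lemma (Lemma A.3).** If nonnegative sequences satisfy
`p^{t+j+l} ≤ r p^{t+l} + Σ_{i=0}^{j+l-1} q^{t+i}` for all `t ≥ 1`, `r ∈ [0,1)`,
and `λ ∈ (0,1)` with `λ^j > r`, then the λ-sequences
`p^{λ,k} = max_{1≤t≤k} p^t λ^{-t}` satisfy
`p^{λ,k} ≤ ((j+l)/(λ^l (λ^j - r))) q^{λ,k} + c_λ` with
`c_λ = (λ^j/(λ^j - r)) max_{1≤t≤j+l} p^t λ^{-t}`. -/
theorem lambda_sequence_lemma (p q : ℕ → ℝ)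
    (hp : ∀ k, 1 ≤ k → 0 ≤ p k) (hq : ∀ k, 1 ≤ k → 0 ≤ q k)
    (r : ℝ) (hr0 : 0 ≤ r) (hr1 : r < 1)
    (j l : ℕ) (hj : 1 ≤ j)
    (hrec : ∀ t, 1 ≤ t →
      p (t + j + l) ≤ r * p (t + l) + ∑ i ∈ Finset.range (j + l), q (t + i))
    (lam : ℝ) (hlam0 : 0 < lam) (hlam1 : lam < 1) (hlamr : r < lam ^ j) :
    ∀ k, ∀ hk : 1 ≤ k,
      (Finset.Icc 1 k).sup' (Finset.nonempty_Icc.mpr hk) (fun t => p t / lam ^ t) ≤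
        ((j + l : ℝ) / (lam ^ l * (lam ^ j - r))) *
          (Finset.Icc 1 k).sup' (Finset.nonempty_Icc.mpr hk) (fun t => q t / lam ^ t) +
        (lam ^ j / (lam ^ j - r)) *
          (Finset.Icc 1 (j + l)).sup' (Finset.nonempty_Icc.mpr (by omega))
            (fun t => p t / lam ^ t) := by
  intro k hk
  set P := (Finset.Icc 1 k).sup' (Finset.nonempty_Icc.mpr hk) (fun t => p t / lam ^ t)
  set Q := (Finset.Icc 1 k).sup' (Finset.nonempty_Icc.mpr hk) (fun t => q t / lam ^ t)
  set M := (Finset.Icc 1 (j + l)).sup' (Finset.nonempty_Icc.mpr (by omega))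
    (fun t => p t / lam ^ t)
  have p_le (t : ℕ) (h1 : 1 ≤ t) (h2 : t ≤ k) : p t / lam ^ t ≤ P :=
    Finset.le_sup' (fun t => p t / lam ^ t) (Finset.mem_Icc.mpr ⟨h1, h2⟩)
  have q_le (t : ℕ) (h1 : 1 ≤ t) (h2 : t ≤ k) : q t / lam ^ t ≤ Q :=
    Finset.le_sup' (fun t => q t / lam ^ t) (Finset.mem_Icc.mpr ⟨h1, h2⟩)
  have p_le_M (t : ℕ) (h1 : 1 ≤ t) (h2 : t ≤ j + l) : p t / lam ^ t ≤ M :=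
    Finset.le_sup' (fun t => p t / lam ^ t) (Finset.mem_Icc.mpr ⟨h1, h2⟩)
  have P_nonneg : 0 ≤ P := (div_nonneg (hp 1 le_rfl) (by positivity)).trans (p_le 1 le_rfl hk)
  have Q_nonneg : 0 ≤ Q := (div_nonneg (hq 1 le_rfl) (by positivity)).trans (q_le 1 le_rfl hk)
  have M_nonneg : 0 ≤ M :=
    (div_nonneg (hp 1 le_rfl) (by positivity)).trans (p_le_M 1 le_rfl (by omega))
  have key : P ≤ r / lam ^ j * P + (j + l : ℝ) / lam ^ (j + l) * Q + M := by
    refine Finset.sup'_le _ _ fun s hs => ?_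
    obtain ⟨hs1, hsk⟩ := Finset.mem_Icc.mp hs
    rcases le_or_gt s (j + l) with hsl | hsl
    · have h1 : 0 ≤ r / lam ^ j * P := by positivity
      have h2 : 0 ≤ (j + l : ℝ) / lam ^ (j + l) * Q := by positivity
      linarith [p_le_M s hs1 hsl]
    obtain ⟨t, rfl⟩ : ∃ t, s = t + j + l := ⟨s - (j + l), by omega⟩
    have ht : 1 ≤ t := by omega
    have hsum : ∑ i ∈ Finset.range (j + l), q (t + i) ≤ (j + l : ℝ) * (Q * lam ^ t) := by
      have h := Finset.sum_le_card_nsmul (Finset.range (j + l)) (fun i => q (t + i))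
        (Q * lam ^ t) fun i hi => by
          have hi := Finset.mem_range.mp hi
          have h := (div_le_iff₀ (by positivity)).mp (q_le (t + i) (by omega) (by omega))
          exact h.trans (mul_le_mul_of_nonneg_left
            (pow_le_pow_of_le_one hlam0.le hlam1.le (by omega)) Q_nonneg)
      simpa using h
    have hpt : p (t + l) ≤ P * lam ^ (t + l) :=
      (div_le_iff₀ (by positivity)).mp (p_le (t + l) (by omega) (by omega))
    have hbound : p (t + j + l) / lam ^ (t + j + l) ≤
        r / lam ^ j * P + (j + l : ℝ) / lam ^ (j + l) * Q := by
      rw [div_le_iff₀ (by positivity)]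
      calc p (t + j + l) ≤ r * (P * lam ^ (t + l)) + (j + l : ℝ) * (Q * lam ^ t) :=
            (hrec t ht).trans (add_le_add (mul_le_mul_of_nonneg_left hpt hr0) hsum)
        _ = _ := by
            simp only [pow_add]
            field_simp
    linarith
  have hd : 0 < lam ^ j - r := sub_pos.mpr hlamr
  calc P = lam ^ j / (lam ^ j - r) * (P - r / lam ^ j * P) := by field_simp
    _ ≤ lam ^ j / (lam ^ j - r) * ((j + l : ℝ) / lam ^ (j + l) * Q + M) :=
        mul_le_mul_of_nonneg_left (by linarith) (by positivity)
    _ = _ := by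
        rw [pow_add]
        field_simp
end

section
/- Let Φ ∈ ℝ^{n×n} be row-stochastic (Φ 1 = 1), let u₁, u₂ ∈ ℝ^n satisfy u₂^T 1 = 1 and u₂^T Φ = u₁^T, and let φ ∈ ℝ^n be arbitrary. Then for every matrix Z ∈ ℝ^{n×p}: ‖(I − 1 u₂^T) Φ Z‖_F ≤ ‖I − 1 u₂^T‖₂ · ‖Φ − 1 φ^T‖_F · ‖(I − 1 u₁^T) Z‖_F, where ‖·‖_F is the Frobenius norm and ‖·‖₂ the spectral norm. -/
open Matrix

/-- The Frobenius norm of a real matrix. -/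
noncomputable def frobNorm {m n : ℕ} (A : Matrix (Fin m) (Fin n) ℝ) : ℝ :=
  Real.sqrt (∑ i, ∑ j, (A i j) ^ 2)

/-- The spectral (operator 2-) norm of a real square matrix. -/
noncomputable def specNorm {n : ℕ} (A : Matrix (Fin n) (Fin n) ℝ) : ℝ :=
  ‖Matrix.toEuclideanCLM (𝕜 := ℝ) A‖

section

attribute [local instance] Matrix.frobeniusNormedAddCommGroup

theorem frobNorm_eq_norm {m n : ℕ} (A : Matrix (Fin m) (Fin n) ℝ) : frobNorm A = ‖A‖ := by
  simp [frobNorm, Matrix.frobenius_norm_def, Real.sqrt_eq_rpow]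

/-- The Frobenius norm is submultiplicative. -/
theorem frobNorm_mul_le {l m n : ℕ} (A : Matrix (Fin l) (Fin m) ℝ)
    (B : Matrix (Fin m) (Fin n) ℝ) : frobNorm (A * B) ≤ frobNorm A * frobNorm B := by
  simpa only [frobNorm_eq_norm] using Matrix.frobenius_norm_mul A B

end

theorem specNorm_nonneg {n : ℕ} (A : Matrix (Fin n) (Fin n) ℝ) : 0 ≤ specNorm A :=
  norm_nonneg _

theorem sum_mulVec_sq_le {n : ℕ} (A : Matrix (Fin n) (Fin n) ℝ) (x : Fin n → ℝ) :
    ∑ i, (A *ᵥ x) i ^ 2 ≤ specNorm A ^ 2 * ∑ i, x i ^ 2 := by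
  have h := (Matrix.toEuclideanCLM (𝕜 := ℝ) A).le_opNorm (WithLp.toLp 2 x)
  have h2 := pow_le_pow_left₀ (norm_nonneg _) h 2
  rw [mul_pow, Matrix.toEuclideanCLM_toLp] at h2
  simpa [EuclideanSpace.real_norm_sq_eq, specNorm] using h2

/-- The spectral norm bounds left multiplication in the Frobenius norm. -/
theorem frobNorm_mul_le_specNorm_mul {n p : ℕ} (A : Matrix (Fin n) (Fin n) ℝ)
    (B : Matrix (Fin n) (Fin p) ℝ) : frobNorm (A * B) ≤ specNorm A * frobNorm B := by
  unfold frobNorm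
  refine Real.sqrt_le_iff.2 ⟨mul_nonneg (specNorm_nonneg A) (Real.sqrt_nonneg _), ?_⟩
  rw [mul_pow, Real.sq_sqrt (by positivity), Finset.sum_comm,
    Finset.sum_comm (f := fun i j => B i j ^ 2), Finset.mul_sum]
  exact Finset.sum_le_sum fun j _ => sum_mulVec_sq_le A fun i => B i j

/-- **The consensus-contraction inequality (A.7).** If `Φ` is row-stochastic,
`u₂ᵀ 1 = 1` and `u₂ᵀ Φ = u₁ᵀ`, then for any vector `φ` and matrix `Z`:
`‖(I - 1u₂ᵀ) Φ Z‖_F ≤ ‖I - 1u₂ᵀ‖₂ ‖Φ - 1φᵀ‖_F ‖(I - 1u₁ᵀ) Z‖_F`. -/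
theorem consensus_contraction_inequality {n p : ℕ}
    (Φ : Matrix (Fin n) (Fin n) ℝ)
    (hΦnn : ∀ i j, 0 ≤ Φ i j)
    (hΦrow : Φ.mulVec (fun _ => 1) = fun _ => 1)
    (u₁ u₂ φ : Fin n → ℝ)
    (hu₂ : u₂ ⬝ᵥ (fun _ => 1) = 1)
    (hu : Matrix.vecMul u₂ Φ = u₁) :
    ∀ Z : Matrix (Fin n) (Fin p) ℝ,
      frobNorm (((1 : Matrix (Fin n) (Fin n) ℝ) - Matrix.vecMulVec (fun _ => 1) u₂) * Φ * Z) ≤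
        specNorm ((1 : Matrix (Fin n) (Fin n) ℝ) - Matrix.vecMulVec (fun _ => 1) u₂) *
        frobNorm (Φ - Matrix.vecMulVec (fun _ => 1) φ) *
        frobNorm (((1 : Matrix (Fin n) (Fin n) ℝ) - Matrix.vecMulVec (fun _ => 1) u₁) * Z) := by
  intro Z
  set P := (1 : Matrix (Fin n) (Fin n) ℝ) - Matrix.vecMulVec (fun _ => 1) u₂ with hP
  have hP1 : P *ᵥ (fun _ => 1) = 0 := by
    rw [hP, Matrix.sub_mulVec, Matrix.one_mulVec, Matrix.vecMulVec_mulVec, hu₂]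
    simp
  have hφ : P * (Φ - Matrix.vecMulVec (fun _ => 1) φ) = P * Φ := by
    rw [Matrix.mul_sub, Matrix.mul_vecMulVec, hP1, Matrix.zero_vecMulVec, sub_zero]
  have hfactor : P * Φ * Z = P * ((Φ - Matrix.vecMulVec (fun _ => 1) φ) *
      (((1 : Matrix (Fin n) (Fin n) ℝ) - Matrix.vecMulVec (fun _ => 1) u₁) * Z)) := by
    rw [← Matrix.mul_assoc, ← Matrix.mul_assoc, hφ, Matrix.mul_sub, Matrix.mul_one,
      Matrix.mul_vecMulVec, ← Matrix.mulVec_mulVec, hΦrow, hP1, Matrix.zero_vecMulVec, sub_zero]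
  rw [hfactor, mul_assoc]
  exact (frobNorm_mul_le_specNorm_mul _ _).trans
    (mul_le_mul_of_nonneg_left (frobNorm_mul_le _ _) (specNorm_nonneg P))
end

section
/- Let {Q^k}_{k≥0} be n×n row-stochastic real matrices, and let B ≥ 1 be an integer and κ ∈ (0,1) be such that for every k ≥ 0 there exists a column index j (depending on k) for which every entry of the j-th column of the product Q^{k+B−1} ⋯ Q^k is at least κ. Then for every k ≥ 0 and t ≥ 0 there exists a stochastic vector φ^{k,t} ∈ ℝ^n such that ‖Q^{k+t−1} ⋯ Q^k − 1 (φ^{k,t})^T‖_F ≤ (2√n / (1−κ)) · (1−κ)^{t/B} (with the empty product for t = 0 interpreted as the identity). -/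
open Matrix

/-- Ordered product `M^{k+t-1} ⋯ M^{k+1} M^k` (the identity for `t = 0`). -/
noncomputable def prodFrom {n : ℕ} (M : ℕ → Matrix (Fin n) (Fin n) ℝ) (k : ℕ) :
    ℕ → Matrix (Fin n) (Fin n) ℝ
  | 0 => 1
  | t + 1 => M (k + t) * prodFrom M k t

theorem sum_abs_sub_le_of_sum_eq {ι ι' : Type*} [Fintype ι] [Fintype ι']
    (P : Matrix ι ι' ℝ) (d s : ℝ) (hs : 0 < s)
    (hP : ∀ l l', ∑ j, |P l j - P l' j| ≤ d) (a b : ι → ℝ)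
    (ha : ∀ l, 0 ≤ a l) (hb : ∀ l, 0 ≤ b l) (hsa : ∑ l, a l = s) (hsb : ∑ l, b l = s) :
    ∑ j, |∑ l, a l * P l j - ∑ l, b l * P l j| ≤ s * d := by
  have key : ∀ j, s * (∑ l, a l * P l j - ∑ l, b l * P l j) =
      ∑ l, ∑ l', a l * b l' * (P l j - P l' j) := by
    intro j
    have h1 : ∑ l, ∑ l', a l * b l' * P l j = s * ∑ l, a l * P l j := by
      rw [← hsb, Finset.sum_mul_sum, Finset.sum_comm]
      exact Finset.sum_congr rfl fun _ _ => Finset.sum_congr rfl fun _ _ => by ring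
    have h2 : ∑ l, ∑ l', a l * b l' * P l' j = s * ∑ l, b l * P l j := by
      rw [← hsa, Finset.sum_mul_sum]
      exact Finset.sum_congr rfl fun _ _ => Finset.sum_congr rfl fun _ _ => by ring
    simp only [mul_sub, Finset.sum_sub_distrib, h1, h2]
  refine le_of_mul_le_mul_left ?_ hs
  calc s * ∑ j, |∑ l, a l * P l j - ∑ l, b l * P l j|
      = ∑ j, |∑ l, ∑ l', a l * b l' * (P l j - P l' j)| := by
        rw [Finset.mul_sum]
        refine Finset.sum_congr rfl fun j _ => ?_
        rw [← key, abs_mul, abs_of_pos hs]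
    _ ≤ ∑ j, ∑ l, ∑ l', a l * b l' * |P l j - P l' j| := by
        refine Finset.sum_le_sum fun j _ => (Finset.abs_sum_le_sum_abs _ _).trans
          (Finset.sum_le_sum fun l _ => (Finset.abs_sum_le_sum_abs _ _).trans
          (Finset.sum_le_sum fun l' _ => ?_))
        rw [abs_mul, abs_of_nonneg (mul_nonneg (ha l) (hb l'))]
    _ = ∑ l, ∑ l', a l * b l' * ∑ j, |P l j - P l' j| := by
        rw [Finset.sum_comm]
        refine Finset.sum_congr rfl fun l _ => ?_
        rw [Finset.sum_comm]
        exact Finset.sum_congr rfl fun l' _ => (Finset.mul_sum _ _ _).symm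
    _ ≤ ∑ l, ∑ l', a l * b l' * d :=
        Finset.sum_le_sum fun l _ => Finset.sum_le_sum fun l' _ =>
          mul_le_mul_of_nonneg_left (hP l l') (mul_nonneg (ha l) (hb l'))
    _ = s * (s * d) := by
        simp only [← Finset.sum_mul, ← Finset.mul_sum, hsa, hsb]
        ring

/-- Left multiplication by a row-stochastic matrix with a column bounded below by `κ` contracts
the `ℓ¹` distances between rows by the factor `1 - κ`. -/
theorem sum_abs_row_sub_mul_le {n : ℕ} (A P : Matrix (Fin n) (Fin n) ℝ) (κ d : ℝ) (hκ : κ < 1)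
    (hA : ∀ i j, 0 ≤ A i j) (hrow : ∀ i, ∑ j, A i j = 1) (c : Fin n) (hc : ∀ i, κ ≤ A i c)
    (hP : ∀ l l', ∑ j, |P l j - P l' j| ≤ d) (i i' : Fin n) :
    ∑ j, |(A * P) i j - (A * P) i' j| ≤ (1 - κ) * d := by
  have hnn : ∀ i l, 0 ≤ A i l - Pi.single (M := fun _ => ℝ) c κ l := by
    intro i l
    rcases eq_or_ne l c with rfl | h
    · simpa using hc i
    · simpa [h] using hA i l
  have hsum : ∀ i, ∑ l, (A i l - Pi.single (M := fun _ => ℝ) c κ l) = 1 - κ := by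
    intro i
    simp [Finset.sum_sub_distrib, hrow]
  have h := sum_abs_sub_le_of_sum_eq P d (1 - κ) (by linarith) hP _ _
    (hnn i) (hnn i') (hsum i) (hsum i')
  simpa only [Matrix.mul_apply, sub_mul, Finset.sum_sub_distrib, sub_sub_sub_cancel_right] using h

theorem prodFrom_add {n : ℕ} (M : ℕ → Matrix (Fin n) (Fin n) ℝ) (k s t : ℕ) :
    prodFrom M k (s + t) = prodFrom M (k + s) t * prodFrom M k s := by
  induction t with
  | zero => simp [prodFrom]
  | succ t ih => rw [← add_assoc, prodFrom, ih, prodFrom, Matrix.mul_assoc, add_assoc]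

theorem prodFrom_mem_rowStochastic {n : ℕ} {M : ℕ → Matrix (Fin n) (Fin n) ℝ}
    (hM : ∀ k, M k ∈ rowStochastic ℝ (Fin n)) (k t : ℕ) :
    prodFrom M k t ∈ rowStochastic ℝ (Fin n) := by
  induction t with
  | zero => exact one_mem _
  | succ t ih => exact mul_mem (hM _) ih

theorem sum_abs_row_sub_prodFrom_le {n : ℕ} {Q : ℕ → Matrix (Fin n) (Fin n) ℝ}
    (hQ : ∀ k, Q k ∈ rowStochastic ℝ (Fin n)) {B : ℕ} {κ : ℝ} (hκ : κ < 1)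
    (hcol : ∀ k, ∃ j, ∀ i, κ ≤ prodFrom Q k B i j) (k r m : ℕ) (i i' : Fin n) :
    ∑ j, |prodFrom Q k (r + B * m) i j - prodFrom Q k (r + B * m) i' j| ≤ 2 * (1 - κ) ^ m := by
  induction m generalizing i i' with
  | zero =>
    have hP := prodFrom_mem_rowStochastic hQ k r
    calc ∑ j, |prodFrom Q k r i j - prodFrom Q k r i' j|
        ≤ ∑ j, (prodFrom Q k r i j + prodFrom Q k r i' j) := by
          refine Finset.sum_le_sum fun j _ => (abs_sub _ _).trans_eq ?_
          rw [abs_of_nonneg (nonneg_of_mem_rowStochastic hP),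
            abs_of_nonneg (nonneg_of_mem_rowStochastic hP)]
      _ = 2 * (1 - κ) ^ 0 := by
          rw [Finset.sum_add_distrib, sum_row_of_mem_rowStochastic hP,
            sum_row_of_mem_rowStochastic hP]
          norm_num
  | succ m ih =>
    obtain ⟨c, hc⟩ := hcol (k + (r + B * m))
    have hA := prodFrom_mem_rowStochastic hQ (k + (r + B * m)) B
    rw [Nat.mul_succ, ← add_assoc, prodFrom_add]
    refine (sum_abs_row_sub_mul_le _ _ κ _ hκ (fun _ _ => nonneg_of_mem_rowStochastic hA)
      (sum_row_of_mem_rowStochastic hA) c hc ih i i').trans_eq ?_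
    ring

theorem frobNorm_le_sqrt_mul {m n : ℕ} (A : Matrix (Fin m) (Fin n) ℝ) {d : ℝ} (hd : 0 ≤ d)
    (hA : ∀ i, ∑ j, |A i j| ≤ d) : frobNorm A ≤ Real.sqrt m * d := by
  have hrow : ∀ i, ∑ j, (A i j) ^ 2 ≤ d ^ 2 := fun i => calc
    ∑ j, (A i j) ^ 2 = ∑ j, |A i j| ^ 2 := by simp only [sq_abs]
    _ ≤ (∑ j, |A i j|) ^ 2 := Finset.sum_sq_le_sq_sum_of_nonneg fun _ _ => abs_nonneg _
    _ ≤ d ^ 2 := by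
      gcongr
      exact hA i
  refine Real.sqrt_le_iff.mpr ⟨by positivity, ?_⟩
  rw [mul_pow, Real.sq_sqrt (Nat.cast_nonneg m)]
  simpa using Finset.sum_le_sum fun i (_ : i ∈ Finset.univ) => hrow i

theorem pow_div_le_rpow {x : ℝ} (hx0 : 0 < x) (hx1 : x ≤ 1) {B : ℕ} (hB : 0 < B) (t : ℕ) :
    x ^ (t / B) ≤ x ^ ((t : ℝ) / (B : ℝ)) / x := by
  rw [← Real.rpow_sub_one hx0.ne', ← Real.rpow_natCast]
  refine Real.rpow_le_rpow_of_exponent_ge hx0 hx1 ?_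
  have hB' : (0 : ℝ) < B := by exact_mod_cast hB
  rw [sub_le_iff_le_add, div_le_iff₀ hB']
  exact_mod_cast (by simpa [mul_comm] using (Nat.lt_mul_div_succ t hB).le :
    t ≤ (t / B + 1) * B)

/-- **Geometric ergodicity of row-stochastic products (Lemma A.1, row half).** If each
`B`-fold product `Q^{k+B-1} ⋯ Q^k` of the row-stochastic matrices has a column that is
entrywise at least `κ`, then for all `k, t` there is a stochastic vector `φ` with
`‖Q^{k+t-1} ⋯ Q^k - 1 φᵀ‖_F ≤ (2√n/(1-κ)) (1-κ)^{t/B}`. -/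
theorem row_stochastic_products_ergodic {n : ℕ}
    (Q : ℕ → Matrix (Fin n) (Fin n) ℝ)
    (hQnn : ∀ k i j, 0 ≤ Q k i j)
    (hQrow : ∀ k i, ∑ j, Q k i j = 1)
    (B : ℕ) (hB : 1 ≤ B) (κ : ℝ) (hκ0 : 0 < κ) (hκ1 : κ < 1)
    (hcol : ∀ k, ∃ j, ∀ i, κ ≤ prodFrom Q k B i j) :
    ∀ k t, ∃ φ : Fin n → ℝ, (∀ i, 0 ≤ φ i) ∧ (∑ i, φ i = 1) ∧
      frobNorm (prodFrom Q k t - Matrix.vecMulVec (fun _ => 1) φ) ≤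
        (2 * Real.sqrt n / (1 - κ)) * (1 - κ) ^ ((t : ℝ) / (B : ℝ)) := by
  intro k t
  have hQ : ∀ k, Q k ∈ rowStochastic ℝ (Fin n) := fun k =>
    mem_rowStochastic_iff_sum.mpr ⟨hQnn k, hQrow k⟩
  obtain ⟨i₀, -⟩ := hcol 0
  have hP := prodFrom_mem_rowStochastic hQ k t
  have hx : 0 < 1 - κ := by linarith
  refine ⟨prodFrom Q k t i₀, fun _ => nonneg_of_mem_rowStochastic hP,
    sum_row_of_mem_rowStochastic hP i₀, ?_⟩
  have hdist : ∀ i, ∑ j, |(prodFrom Q k t -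
      Matrix.vecMulVec (fun _ => 1) (prodFrom Q k t i₀) : Matrix (Fin n) (Fin n) ℝ) i j| ≤
        2 * (1 - κ) ^ (t / B) := by
    intro i
    have h := sum_abs_row_sub_prodFrom_le hQ hκ1 hcol k (t % B) (t / B) i i₀
    rw [Nat.mod_add_div] at h
    simpa [Matrix.vecMulVec_apply] using h
  calc _ ≤ Real.sqrt n * (2 * (1 - κ) ^ (t / B)) :=
        frobNorm_le_sqrt_mul _ (by positivity) hdist
    _ ≤ Real.sqrt n * (2 * ((1 - κ) ^ ((t : ℝ) / (B : ℝ)) / (1 - κ))) := by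
        gcongr
        exact pow_div_le_rpow hx (by linarith) hB t
    _ = _ := by ring
end
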